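/- Let U be an open neighborhood of 0 in ℝⁿ such that t·x ∈ U whenever x ∈ U and |t| ≤ 1. Let m be a positive integer and let X be a smooth vector field on U whose k-th component X_k has weight ≥ w_k − m for every k = 1,…,n. Then there is a smooth map X̂ : (−1,1) × U → ℝⁿ such that X̂(t,x) = t^m (δ_t^*X)(x) for all t ≠ 0 with |t| < 1 and all x ∈ U, and X̂(0,x) has k-th component Σ_{α : ⟨α⟩ = w_k − m} (1/α!) ∂^α X_k(0) x^α. -/

import Mathlib

open scoped BigOperators
open Filter Topology

namespace Carnot

/-- Anisotropic dilation `t · x = (t^{w_1} x_1, …, t^{w_n} x_n)`. -/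
def dil {n : ℕ} (w : Fin n → ℕ) (t : ℝ) (x : Fin n → ℝ) : Fin n → ℝ :=
  fun i => t ^ (w i) * x i

/-- Weighted length `⟨α⟩` of a multi-index. -/
def wlen {n : ℕ} (w : Fin n → ℕ) (α : Fin n → ℕ) : ℕ := ∑ i, w i * α i

/-- Length `|α|` of a multi-index. -/
def mlen {n : ℕ} (α : Fin n → ℕ) : ℕ := ∑ i, α i

/-- A vector field acting on a function: `(Xf)(x) = Df(x)[X(x)]`. -/
noncomputable def vf {n : ℕ} (X : (Fin n → ℝ) → (Fin n → ℝ)) (f : (Fin n → ℝ) → ℝ) :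
    (Fin n → ℝ) → ℝ :=
  fun x => fderiv ℝ f x (X x)

/-- Iterated action `X_I f = X_{i_1}(X_{i_2}(⋯(X_{i_k} f)))`. -/
noncomputable def vfSeq {n : ℕ} (X : Fin n → (Fin n → ℝ) → (Fin n → ℝ)) :
    List (Fin n) → ((Fin n → ℝ) → ℝ) → ((Fin n → ℝ) → ℝ)
  | [], f => f
  | i :: I, f => vf (X i) (vfSeq X I f)

/-- Weight `⟨I⟩` of a finite sequence of indices. -/
def seqW {n : ℕ} (w : Fin n → ℕ) (I : List (Fin n)) : ℕ := (I.map w).sum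

/-- The list `(1,…,1,2,…,2,…,n,…,n)` with `i` repeated `α i` times. -/
def multiList {n : ℕ} (α : Fin n → ℕ) : List (Fin n) :=
  (List.finRange n).flatMap fun i => List.replicate (α i) i

/-- `X^α f = X_1^{α_1} ⋯ X_n^{α_n} f`. -/
noncomputable def vfPow {n : ℕ} (X : Fin n → (Fin n → ℝ) → (Fin n → ℝ)) (α : Fin n → ℕ)
    (f : (Fin n → ℝ) → ℝ) : (Fin n → ℝ) → ℝ :=
  vfSeq X (multiList α) f

/-- Partial derivative `∂^α f`. -/
noncomputable def pdPow {n : ℕ} (α : Fin n → ℕ) (f : (Fin n → ℝ) → ℝ) : (Fin n → ℝ) → ℝ :=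
  vfPow (fun i => fun _ => Pi.single i (1 : ℝ)) α f

/-- Lie bracket of two vector fields. -/
noncomputable def lieBk {n : ℕ} (X Y : (Fin n → ℝ) → (Fin n → ℝ)) : (Fin n → ℝ) → (Fin n → ℝ) :=
  fun x => fderiv ℝ Y x (X x) - fderiv ℝ X x (Y x)

/-- A weight sequence: non-decreasing, positive, starting at `1`. -/
structure IsWeight {n : ℕ} (w : Fin n → ℕ) : Prop where
  mono : Monotone w
  pos : ∀ i, 0 < w i
  first : ∀ h : 0 < n, w ⟨0, h⟩ = 1

/-- An `H`-frame on `V`. -/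
structure IsHFrame {n : ℕ} (w : Fin n → ℕ) (X : Fin n → (Fin n → ℝ) → (Fin n → ℝ))
    (V : Set (Fin n → ℝ)) : Prop where
  smooth : ∀ j, ContDiffOn ℝ (⊤ : ℕ∞) (X j) V
  basis : ∀ x ∈ V, LinearIndependent ℝ fun j => X j x
  bracket : ∃ L : Fin n → Fin n → Fin n → (Fin n → ℝ) → ℝ,
    (∀ i j k, ContDiffOn ℝ (⊤ : ℕ∞) (L i j k) V) ∧
    (∀ i j k, ¬ w k ≤ w i + w j → ∀ x ∈ V, L i j k x = 0) ∧
    ∀ i j, ∀ x ∈ V, lieBk (X i) (X j) x = ∑ k, L i j k x • X k x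

/-- `f` has order `≥ N` at `a` with respect to the frame `X`. -/
def OrderGe {n : ℕ} (w : Fin n → ℕ) (X : Fin n → (Fin n → ℝ) → (Fin n → ℝ))
    (f : (Fin n → ℝ) → ℝ) (a : Fin n → ℝ) (N : ℕ) : Prop :=
  ∀ I : List (Fin n), seqW w I < N → vfSeq X I f a = 0

/-- `f` has order exactly `N` at `a` with respect to the frame `X`. -/
def OrderEq {n : ℕ} (w : Fin n → ℕ) (X : Fin n → (Fin n → ℝ) → (Fin n → ℝ))
    (f : (Fin n → ℝ) → ℝ) (a : Fin n → ℝ) (N : ℕ) : Prop :=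
  OrderGe w X f a N ∧ ∃ I : List (Fin n), seqW w I = N ∧ vfSeq X I f a ≠ 0

/-- `f` has weight `≥ N`. -/
def WeightGe {n : ℕ} (w : Fin n → ℕ) (f : (Fin n → ℝ) → ℝ) (N : ℤ) : Prop :=
  ∀ α : Fin n → ℕ, (wlen w α : ℤ) < N → pdPow α f 0 = 0

/-- `f` has weight exactly `N`. -/
def WeightEq {n : ℕ} (w : Fin n → ℕ) (f : (Fin n → ℝ) → ℝ) (N : ℤ) : Prop :=
  WeightGe w f N ∧ ∃ α : Fin n → ℕ, (wlen w α : ℤ) = N ∧ pdPow α f 0 ≠ 0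

/-- A pseudo-norm for the anisotropic dilations. -/
structure IsPseudoNorm {n : ℕ} (w : Fin n → ℕ) (ρ : (Fin n → ℝ) → ℝ) : Prop where
  cont : Continuous ρ
  nonneg : ∀ x, 0 ≤ ρ x
  pos : ∀ x, x ≠ 0 → 0 < ρ x
  homog : ∀ t x, ρ (dil w t x) = |t| * ρ x

/-- Multi-indices with all entries `< B`. -/
def mIdx (n B : ℕ) : Finset (Fin n → ℕ) := Fintype.piFinset fun _ => Finset.range B

/-- The monomial `x^α`. -/
def monom {n : ℕ} (α : Fin n → ℕ) (x : Fin n → ℝ) : ℝ := ∏ i, x i ^ α i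

/-- Taylor coefficient `(1/α!) ∂^α f(0)`. -/
noncomputable def taylorCoeff {n : ℕ} (α : Fin n → ℕ) (f : (Fin n → ℝ) → ℝ) : ℝ :=
  ((∏ i, Nat.factorial (α i) : ℕ) : ℝ)⁻¹ * pdPow α f 0

/-- The homogeneous part `f^[ℓ]` of degree `ℓ` of the Taylor series of `f` at `0`. -/
noncomputable def homPart {n : ℕ} (w : Fin n → ℕ) (f : (Fin n → ℝ) → ℝ) (ℓ : ℕ) :
    (Fin n → ℝ) → ℝ :=
  fun x => ∑ α ∈ (mIdx n (ℓ + 1)).filter (fun α => wlen w α = ℓ),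
    taylorCoeff α f * monom α x

/-- `u_t = O(t^m)` in `C^∞(U)` as `t → 0`. -/
def BigOC {n : ℕ} (U : Set (Fin n → ℝ)) (u : ℝ → (Fin n → ℝ) → ℝ) (m : ℤ) : Prop :=
  ∀ K : Set (Fin n → ℝ), K ⊆ U → IsCompact K → ∀ β : Fin n → ℕ,
    ∃ C : ℝ, ∀ᶠ t in 𝓝[≠] (0 : ℝ), ∀ x ∈ K, |pdPow β (u t) x| ≤ C * |t| ^ m

/-- Componentwise `O(t^m)` in `C^∞(U)` for families of vector fields. -/
def BigOCVF {n : ℕ} (U : Set (Fin n → ℝ)) (u : ℝ → (Fin n → ℝ) → Fin n → ℝ)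
    (m : ℤ) : Prop :=
  ∀ K : Set (Fin n → ℝ), K ⊆ U → IsCompact K → ∀ β : Fin n → ℕ, ∀ k : Fin n,
    ∃ C : ℝ, ∀ᶠ t in 𝓝[≠] (0 : ℝ), ∀ x ∈ K,
      |pdPow β (fun y => u t y k) x| ≤ C * |t| ^ m

/-- `Θ = O_w(‖x‖^{w+m})` near `x = 0`. -/
def IsOw {n : ℕ} (w : Fin n → ℕ) (ρ : (Fin n → ℝ) → ℝ)
    (Θ : (Fin n → ℝ) → (Fin n → ℝ)) (m : ℤ) : Prop :=
  ∀ k, ∃ C : ℝ, ∀ᶠ x in 𝓝 (0 : Fin n → ℝ), |Θ x k| ≤ C * ρ x ^ ((w k : ℤ) + m)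

/-- A `w`-homogeneous map. -/
def WHomog {n : ℕ} (w : Fin n → ℕ) (φ : (Fin n → ℝ) → (Fin n → ℝ)) : Prop :=
  ∀ t x, φ (dil w t x) = dil w t (φ x)

/-- A map whose components are polynomial functions. -/
def IsPolyMap {n : ℕ} (φ : (Fin n → ℝ) → (Fin n → ℝ)) : Prop :=
  ∀ k, ∃ p : MvPolynomial (Fin n) ℝ, ∀ x, φ x k = MvPolynomial.eval x p

/-- A vector field homogeneous of degree `m`: `δ_t^* Y = t^m Y` for `t ≠ 0`. -/
def VFHomog {n : ℕ} (w : Fin n → ℕ) (Y : (Fin n → ℝ) → (Fin n → ℝ)) (m : ℤ) : Prop :=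
  ∀ t : ℝ, t ≠ 0 → ∀ x k, (t : ℝ) ^ (-(w k : ℤ)) * Y (dil w t x) k = t ^ m * Y x k

/-- A vector field has weight `W`: each component `X_k` has weight `≥ W + w_k`,
with equality for some `k`. -/
def VFWeightEq {n : ℕ} (w : Fin n → ℕ) (X : (Fin n → ℝ) → (Fin n → ℝ)) (W : ℤ) :
    Prop :=
  (∀ k, ∀ α : Fin n → ℕ, (wlen w α : ℤ) < W + w k →
    pdPow α (fun y => X y k) 0 = 0) ∧
  ∃ k, ∃ α : Fin n → ℕ, (wlen w α : ℤ) = W + w k ∧ pdPow α (fun y => X y k) 0 ≠ 0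

/-- The homogeneous part `X^[ℓ]` of degree `ℓ` of a vector field. -/
noncomputable def vfPart {n : ℕ} (w : Fin n → ℕ) (X : (Fin n → ℝ) → (Fin n → ℝ)) (ℓ : ℤ) :
    (Fin n → ℝ) → Fin n → ℝ :=
  fun x k => ∑ α ∈ (mIdx n ((ℓ + w k).toNat + 1)).filter
      (fun α => (wlen w α : ℤ) = ℓ + w k),
    taylorCoeff α (fun y => X y k) * monom α x

/-- `φ` produces privileged coordinates at `a` adapted to the `H`-frame `X`:
it is linearly adapted at `a` and each component has order `w_k` at `a`. -/
def PrivilegedAt {n : ℕ} (w : Fin n → ℕ) (X : Fin n → (Fin n → ℝ) → (Fin n → ℝ))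
    (a : Fin n → ℝ) (φ : (Fin n → ℝ) → (Fin n → ℝ)) : Prop :=
  (∀ j, fderiv ℝ φ a (X j a) = Pi.single j 1) ∧
  ∀ k, OrderEq w X (fun x => φ x k) a (w k)


/-- Smooth dependence of an interval integral over `[0, 1]` on its parameters. -/
theorem contDiffOn_intervalIntegral_param {H E : Type} [NormedAddCommGroup H] [NormedSpace ℝ H]
    [FiniteDimensional ℝ H] [NormedAddCommGroup E] [NormedSpace ℝ E]
    {V : Set H} (hV : IsOpen V) {W : Set (ℝ × H)} (hW : IsOpen W)
    (hVW : Set.Icc (0 : ℝ) 1 ×ˢ V ⊆ W) {F : ℝ × H → E}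
    (hF : ContDiffOn ℝ (⊤ : ℕ∞) F W) :
    ContDiffOn ℝ (⊤ : ℕ∞) (fun x => ∫ s in (0 : ℝ)..1, F (s, x)) V := by
  have deriv_step : ∀ {E : Type} [NormedAddCommGroup E] [NormedSpace ℝ E] {F : ℝ × H → E},
      ContDiffOn ℝ (⊤ : ℕ∞) F W → ∀ x₀ ∈ V,
      HasFDerivAt (fun x => ∫ s in (0 : ℝ)..1, F (s, x))
        (∫ s in (0 : ℝ)..1, (fderiv ℝ F (s, x₀)).comp (ContinuousLinearMap.inr ℝ ℝ H)) x₀ := by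
    intro E _ _ F hF x₀ hx₀
    have : ProperSpace H := FiniteDimensional.proper ℝ H
    obtain ⟨B, hB, hBV, hBc⟩ := local_compact_nhds (hV.mem_nhds hx₀)
    have hF' : ContinuousOn
        (fun p => (fderiv ℝ F p).comp (ContinuousLinearMap.inr ℝ ℝ H)) W :=
      (hF.continuousOn_fderiv_of_isOpen hW (by simp)).clm_comp continuousOn_const
    have hBW : Set.Icc (0 : ℝ) 1 ×ˢ B ⊆ W := (Set.prod_mono le_rfl hBV).trans hVW
    obtain ⟨C, hC⟩ := (isCompact_Icc.prod hBc).exists_bound_of_continuousOn (hF'.mono hBW)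
    have slice : ∀ {G : Type} [NormedAddCommGroup G] {g : ℝ × H → G}, ContinuousOn g W →
        ∀ x ∈ V, IntervalIntegrable (fun s => g (s, x)) MeasureTheory.volume 0 1 := by
      intro G _ g hg x hx
      apply ContinuousOn.intervalIntegrable
      rw [Set.uIcc_of_le zero_le_one]
      exact hg.comp (by fun_prop) fun s hs => hVW ⟨hs, hx⟩
    have hIoc : ∀ s ∈ Set.uIoc (0 : ℝ) 1, s ∈ Set.Icc (0 : ℝ) 1 := fun s hs => by
      rw [Set.uIoc_of_le zero_le_one] at hs
      exact Set.Ioc_subset_Icc_self hs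
    refine intervalIntegral.hasFDerivAt_integral_of_dominated_of_fderiv_le
      (F := fun x s => F (s, x))
      (F' := fun x s => (fderiv ℝ F (s, x)).comp (ContinuousLinearMap.inr ℝ ℝ H))
      (bound := fun _ => C) hB ?_ (slice hF.continuousOn x₀ hx₀) ?_ ?_ (by simp) ?_
    · filter_upwards [hV.mem_nhds hx₀] with x hx
      exact (intervalIntegrable_iff.1 (slice hF.continuousOn x hx)).aestronglyMeasurable
    · exact (intervalIntegrable_iff.1 (slice hF' x₀ hx₀)).aestronglyMeasurable
    · exact .of_forall fun s hs x hx => hC (s, x) ⟨hIoc s hs, hx⟩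
    · refine .of_forall fun s hs x hx => ?_
      have hmem : (s, x) ∈ W := hBW ⟨hIoc s hs, hx⟩
      have := ((hF.contDiffAt (hW.mem_nhds hmem)).differentiableAt (by simp)).hasFDerivAt
      exact this.comp x (hasFDerivAt_prodMk_right s x)
  rw [contDiffOn_infty]
  intro n
  induction n generalizing E with
  | zero =>
    exact contDiffOn_zero.2 fun x hx => (deriv_step hF x hx).continuousAt.continuousWithinAt
  | succ n ih =>
    push_cast
    rw [contDiffOn_succ_iff_fderiv_of_isOpen hV]
    refine ⟨fun x hx => (deriv_step hF x hx).differentiableAt.differentiableWithinAt,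
      by simp, ?_⟩
    refine (ih (F := fun p => (fderiv ℝ F p).comp (ContinuousLinearMap.inr ℝ ℝ H))
      ((hF.fderiv_of_isOpen hW (by simp)).clm_comp contDiffOn_const)).congr fun x hx => ?_
    exact (deriv_step hF x hx).fderiv

/-- The coordinate vector fields. -/
abbrev coordVF (n : ℕ) : Fin n → (Fin n → ℝ) → (Fin n → ℝ) :=
  fun i => fun _ => Pi.single i (1 : ℝ)

theorem contDiffOn_vf_coord {n : ℕ} {U : Set (Fin n → ℝ)} (hU : IsOpen U)
    {f : (Fin n → ℝ) → ℝ} (hf : ContDiffOn ℝ (⊤ : ℕ∞) f U) (i : Fin n) :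
    ContDiffOn ℝ (⊤ : ℕ∞) (vf (coordVF n i) f) U :=
  (hf.fderiv_of_isOpen hU (by simp)).clm_apply contDiffOn_const

theorem vfSeq_append {n : ℕ} (X : Fin n → (Fin n → ℝ) → (Fin n → ℝ)) (L L' : List (Fin n))
    (f : (Fin n → ℝ) → ℝ) : vfSeq X (L ++ L') f = vfSeq X L (vfSeq X L' f) := by
  induction L with
  | nil => rfl
  | cons i L ih => simp [vfSeq, ih]

theorem contDiff_dil {n : ℕ} (w : Fin n → ℕ) :
    ContDiff ℝ (⊤ : ℕ∞) fun p : ℝ × (Fin n → ℝ) => dil w p.1 p.2 := by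
  unfold dil
  fun_prop

theorem hasDerivAt_comp_dil {n : ℕ} (w : Fin n → ℕ) {f : (Fin n → ℝ) → ℝ} {t : ℝ}
    {x : Fin n → ℝ} (hf : DifferentiableAt ℝ f (dil w t x)) :
    HasDerivAt (fun t => f (dil w t x))
      (∑ i, w i * t ^ (w i - 1) * x i * vf (coordVF n i) f (dil w t x)) t := by
  have hd : HasDerivAt (fun t => dil w t x) (fun i => w i * t ^ (w i - 1) * x i) t :=
    hasDerivAt_pi.2 fun i => (hasDerivAt_pow (w i) t).mul_const (x i)
  refine (hf.hasFDerivAt.comp_hasDerivAt t hd).congr_deriv ?_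
  rw [pi_eq_sum_univ' (fun i => (w i : ℝ) * t ^ (w i - 1) * x i), map_sum]
  refine Finset.sum_congr rfl fun i _ => ?_
  rw [map_smul, smul_eq_mul, vf]

/-- If `f` vanishes to weighted order `N` at `0`, then `f(δ_t x)` is divisible by `t ^ N`. -/
theorem exists_contDiffOn_comp_dil_eq_pow_mul {n : ℕ} {w : Fin n → ℕ} (hw : ∀ i, 0 < w i)
    {U : Set (Fin n → ℝ)} (hU : IsOpen U)
    (hstar : ∀ x ∈ U, ∀ t : ℝ, |t| ≤ 1 → dil w t x ∈ U) (N : ℕ) :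
    ∀ {f : (Fin n → ℝ) → ℝ}, ContDiffOn ℝ (⊤ : ℕ∞) f U →
      (∀ L : List (Fin n), seqW w L < N → vfSeq (coordVF n) L f 0 = 0) →
      ∃ G : ℝ × (Fin n → ℝ) → ℝ, ContDiffOn ℝ (⊤ : ℕ∞) G (Set.Ioo (-1 : ℝ) 1 ×ˢ U) ∧
        ∀ t ∈ Set.Ioo (-1 : ℝ) 1, ∀ x ∈ U, f (dil w t x) = t ^ N * G (t, x) := by
  have hmem : ∀ t ∈ Set.Ioo (-1 : ℝ) 1, ∀ x ∈ U, dil w t x ∈ U := fun t ht x hx =>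
    hstar x hx t (abs_le.2 ⟨ht.1.le, ht.2.le⟩)
  have hscale : ∀ t ∈ Set.Ioo (-1 : ℝ) 1, ∀ s ∈ Set.Icc (0 : ℝ) 1,
      s * t ∈ Set.Ioo (-1 : ℝ) 1 := by
    rintro t ⟨h1, h2⟩ s ⟨h3, h4⟩
    constructor <;> nlinarith
  induction N using Nat.strong_induction_on with
  | _ N ih =>
  intro f hf hvan
  obtain _ | M := N
  · refine ⟨fun p => f (dil w p.1 p.2), ?_, by simp⟩
    exact hf.comp (contDiff_dil w).contDiffOn fun p hp => hmem p.1 hp.1 p.2 hp.2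
  have step : ∀ i, ∃ G : ℝ × (Fin n → ℝ) → ℝ,
      ContDiffOn ℝ (⊤ : ℕ∞) G (Set.Ioo (-1 : ℝ) 1 ×ˢ U) ∧
      ∀ t ∈ Set.Ioo (-1 : ℝ) 1, ∀ x ∈ U,
        vf (coordVF n i) f (dil w t x) = t ^ (M + 1 - w i) * G (t, x) := fun i => by
    have := hw i
    refine ih (M + 1 - w i) (by omega) (contDiffOn_vf_coord hU hf i) fun L hL => ?_
    have := hvan (L ++ [i]) (by simp [seqW] at hL ⊢; omega)
    rwa [vfSeq_append] at this
  choose G hG hfG using step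
  let K : ℝ × (Fin n → ℝ) → ℝ := fun p =>
    ∑ i, w i * p.2 i * (p.1 ^ (w i - 1 + (M + 1 - w i) - M) * G i p)
  have hK : ContDiffOn ℝ (⊤ : ℕ∞) K (Set.Ioo (-1 : ℝ) 1 ×ˢ U) := by
    refine ContDiffOn.sum fun i _ => ?_
    have h1 : ContDiff ℝ (⊤ : ℕ∞) fun p : ℝ × (Fin n → ℝ) => (w i : ℝ) * p.2 i := by fun_prop
    have h2 : ContDiff ℝ (⊤ : ℕ∞) fun p : ℝ × (Fin n → ℝ) =>
      p.1 ^ (w i - 1 + (M + 1 - w i) - M) := by fun_prop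
    exact h1.contDiffOn.mul (h2.contDiffOn.mul (hG i))
  have hderiv : ∀ t ∈ Set.Ioo (-1 : ℝ) 1, ∀ x ∈ U,
      HasDerivAt (fun t => f (dil w t x)) (t ^ M * K (t, x)) t := fun t ht x hx => by
    have hd := hasDerivAt_comp_dil (w := w)
      ((hf.contDiffAt (hU.mem_nhds (hmem t ht x hx))).differentiableAt (by simp))
    convert hd using 1
    simp only [K, Finset.mul_sum]
    refine Finset.sum_congr rfl fun i _ => ?_
    rw [hfG i t ht x hx]
    have := hw i
    have hpow : t ^ (w i - 1) * t ^ (M + 1 - w i)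
        = t ^ M * t ^ (w i - 1 + (M + 1 - w i) - M) := by
      rw [← pow_add, ← pow_add]
      congr 1
      omega
    linear_combination (-(w i : ℝ) * x i * G i (t, x)) * hpow
  refine ⟨fun p => ∫ s in (0 : ℝ)..1, s ^ M * K (s * p.1, p.2), ?_, fun t ht x hx => ?_⟩
  · have hφ : ContDiff ℝ (⊤ : ℕ∞) fun q : ℝ × ℝ × (Fin n → ℝ) => (q.1 * q.2.1, q.2.2) := by
      fun_prop
    have hs : ContDiff ℝ (⊤ : ℕ∞) fun q : ℝ × ℝ × (Fin n → ℝ) => q.1 ^ M := by fun_prop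
    exact contDiffOn_intervalIntegral_param (isOpen_Ioo.prod hU)
      ((isOpen_Ioo.prod hU).preimage hφ.continuous)
      (fun q hq => ⟨hscale _ hq.2.1 _ hq.1, hq.2.2⟩)
      (F := fun q => q.1 ^ M * K (q.1 * q.2.1, q.2.2))
      (hs.contDiffOn.mul (hK.comp hφ.contDiffOn fun q hq => hq))
  · have hd : ∀ s ∈ Set.uIcc (0 : ℝ) 1, HasDerivAt (fun s => f (dil w (s * t) x))
        (t ^ (M + 1) * (s ^ M * K (s * t, x))) s := fun s hs => by
      rw [Set.uIcc_of_le zero_le_one] at hs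
      have := (hderiv (s * t) (hscale t ht s hs) x hx).comp s ((hasDerivAt_id s).mul_const t)
      refine this.congr_deriv ?_
      ring
    have hc : ContinuousOn (fun s => t ^ (M + 1) * (s ^ M * K (s * t, x)))
        (Set.uIcc (0 : ℝ) 1) := by
      rw [Set.uIcc_of_le zero_le_one]
      refine continuousOn_const.mul ((continuousOn_pow M).mul ?_)
      exact hK.continuousOn.comp (by fun_prop) fun s hs => ⟨hscale t ht s hs, hx⟩
    have h := intervalIntegral.integral_eq_sub_of_hasDerivAt hd hc.intervalIntegrable
    have hz : dil w 0 x = 0 := by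
      ext i
      simp [dil, (hw i).ne']
    have hf0 : f 0 = 0 := hvan [] (by simp [seqW])
    rw [intervalIntegral.integral_const_mul] at h
    simpa [hz, hf0] using h.symm

theorem vf_congr {n : ℕ} {U : Set (Fin n → ℝ)} (hU : IsOpen U)
    (X : (Fin n → ℝ) → (Fin n → ℝ)) {f g : (Fin n → ℝ) → ℝ} (h : Set.EqOn f g U) :
    Set.EqOn (vf X f) (vf X g) U := fun x hx => by
  simp only [vf, (h.eventuallyEq_of_mem (hU.mem_nhds hx)).fderiv_eq]

theorem contDiffOn_vfSeq_coord {n : ℕ} {U : Set (Fin n → ℝ)} (hU : IsOpen U)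
    {f : (Fin n → ℝ) → ℝ} (hf : ContDiffOn ℝ (⊤ : ℕ∞) f U) (L : List (Fin n)) :
    ContDiffOn ℝ (⊤ : ℕ∞) (vfSeq (coordVF n) L f) U := by
  induction L with
  | nil => exact hf
  | cons i L ih => exact contDiffOn_vf_coord hU ih i

theorem vfSeq_coord_sub {n : ℕ} {U : Set (Fin n → ℝ)} (hU : IsOpen U)
    {f g : (Fin n → ℝ) → ℝ} (hf : ContDiffOn ℝ (⊤ : ℕ∞) f U)
    (hg : ContDiffOn ℝ (⊤ : ℕ∞) g U) (L : List (Fin n)) :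
    Set.EqOn (vfSeq (coordVF n) L fun x => f x - g x)
      (fun x => vfSeq (coordVF n) L f x - vfSeq (coordVF n) L g x) U := by
  induction L with
  | nil => exact fun x _ => rfl
  | cons i L ih =>
    intro x hx
    have hd : ∀ {h : (Fin n → ℝ) → ℝ}, ContDiffOn ℝ (⊤ : ℕ∞) h U →
        DifferentiableAt ℝ (vfSeq (coordVF n) L h) x := fun hh =>
      ((contDiffOn_vfSeq_coord hU hh L).contDiffAt (hU.mem_nhds hx)).differentiableAt (by simp)
    refine (vf_congr hU (coordVF n i) ih hx).trans ?_
    simp only [vf, vfSeq, fderiv_fun_sub (hd hf) (hd hg), sub_apply]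

theorem vf_coord_comm {n : ℕ} {U : Set (Fin n → ℝ)} (hU : IsOpen U)
    {f : (Fin n → ℝ) → ℝ} (hf : ContDiffOn ℝ (⊤ : ℕ∞) f U) (i j : Fin n) :
    Set.EqOn (vf (coordVF n i) (vf (coordVF n j) f))
      (vf (coordVF n j) (vf (coordVF n i) f)) U := fun x hx => by
  have hd : DifferentiableAt ℝ (fderiv ℝ f) x :=
    ((hf.fderiv_of_isOpen (m := (⊤ : ℕ∞)) hU (by simp)).contDiffAt
      (hU.mem_nhds hx)).differentiableAt (by simp)
  have key : ∀ a b : Fin n → ℝ,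
      fderiv ℝ (fun y => fderiv ℝ f y a) x b = fderiv ℝ (fderiv ℝ f) x b a := fun a b => by
    rw [(hd.hasFDerivAt.clm_apply (hasFDerivAt_const a x)).fderiv]
    simp
  have hs := (hf.contDiffAt (hU.mem_nhds hx)).isSymmSndFDerivAt (by
    rw [minSmoothness_of_isRCLikeNormedField]
    exact WithTop.coe_le_coe.2 (le_top : (2 : ℕ∞) ≤ ⊤))
  change fderiv ℝ (fun y => fderiv ℝ f y _) x _ = fderiv ℝ (fun y => fderiv ℝ f y _) x _
  rw [key, key]
  exact hs _ _

theorem vfSeq_coord_perm {n : ℕ} {U : Set (Fin n → ℝ)} (hU : IsOpen U)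
    {f : (Fin n → ℝ) → ℝ} (hf : ContDiffOn ℝ (⊤ : ℕ∞) f U) {L L' : List (Fin n)}
    (h : L.Perm L') :
    Set.EqOn (vfSeq (coordVF n) L f) (vfSeq (coordVF n) L' f) U := by
  induction h with
  | nil => exact fun _ _ => rfl
  | cons i _ ih => exact vf_congr hU _ ih
  | swap i j L => exact vf_coord_comm hU (contDiffOn_vfSeq_coord hU hf L) j i
  | trans _ _ ih₁ ih₂ => exact ih₁.trans ih₂

theorem count_multiList {n : ℕ} (α : Fin n → ℕ) (i : Fin n) : (multiList α).count i = α i := by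
  rw [multiList, List.count_flatMap, ← List.ofFn_eq_map, List.sum_ofFn]
  simp [List.count_replicate]

theorem seqW_eq_wlen_count {n : ℕ} (w : Fin n → ℕ) (L : List (Fin n)) :
    seqW w L = wlen w fun i => L.count i := by
  induction L with
  | nil => simp [seqW, wlen]
  | cons j L ih =>
    have : seqW w (j :: L) = w j + seqW w L := by simp [seqW]
    rw [this, ih]
    simp [wlen, List.count_cons, mul_add, Finset.sum_add_distrib, add_comm]

theorem vfSeq_coord_eq_pdPow {n : ℕ} {U : Set (Fin n → ℝ)} (hU : IsOpen U)
    {f : (Fin n → ℝ) → ℝ} (hf : ContDiffOn ℝ (⊤ : ℕ∞) f U) (L : List (Fin n)) :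
    Set.EqOn (vfSeq (coordVF n) L f) (pdPow (fun i => L.count i) f) U :=
  vfSeq_coord_perm hU hf <| List.perm_iff_count.2 fun i =>
    (count_multiList (fun i => L.count i) i).symm

theorem contDiff_mvPolynomial_eval {n : ℕ} (p : MvPolynomial (Fin n) ℝ) :
    ContDiff ℝ (⊤ : ℕ∞) fun x : Fin n → ℝ => MvPolynomial.eval x p := by
  induction p using MvPolynomial.induction_on with
  | C a => simpa using contDiff_const
  | add p q hp hq => simpa using hp.add hq
  | mul_X p i hp => simpa using hp.mul (contDiff_apply ℝ ℝ i)

theorem vf_coord_mvPolynomial_eval {n : ℕ} (i : Fin n) (p : MvPolynomial (Fin n) ℝ) :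
    (vf (coordVF n i) fun x => MvPolynomial.eval x p) =
      fun x => MvPolynomial.eval x (MvPolynomial.pderiv i p) := by
  have hd : ∀ (p : MvPolynomial (Fin n) ℝ) (x : Fin n → ℝ),
      DifferentiableAt ℝ (fun x => MvPolynomial.eval x p) x := fun p x =>
    (contDiff_mvPolynomial_eval p).contDiffAt.differentiableAt (by simp)
  ext x
  induction p using MvPolynomial.induction_on with
  | C a => simp [vf]
  | add p q hp hq =>
    simp only [vf, map_add] at hp hq ⊢
    rw [fderiv_fun_add (hd p x) (hd q x), add_apply, hp, hq]
  | mul_X p j hp =>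
    simp only [vf, map_mul, MvPolynomial.eval_X] at hp ⊢
    rw [fderiv_fun_mul (hd p x) (differentiableAt_apply j x)]
    simp [hp, MvPolynomial.pderiv_X, (hasFDerivAt_apply j x).fderiv,
      Pi.single_apply, apply_ite, eq_comm]

theorem vfSeq_coord_mvPolynomial_eval {n : ℕ} (L : List (Fin n))
    (p : MvPolynomial (Fin n) ℝ) :
    (vfSeq (coordVF n) L fun x => MvPolynomial.eval x p) =
      fun x => MvPolynomial.eval x (L.foldr (fun i q => MvPolynomial.pderiv i q) p) := by
  induction L with
  | nil => rfl
  | cons i L ih => rw [vfSeq, ih, vf_coord_mvPolynomial_eval, List.foldr_cons]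

theorem factorial_mul_coeff_foldr_pderiv {n : ℕ} (L : List (Fin n))
    (p : MvPolynomial (Fin n) ℝ) (β : Fin n →₀ ℕ) :
    (∏ i, ((β i).factorial : ℝ)) *
        (L.foldr (fun i q => MvPolynomial.pderiv i q) p).coeff β =
      (∏ i, ((β i + L.count i).factorial : ℝ)) *
        p.coeff (β + Finsupp.equivFunOnFinite.symm fun i => L.count i) := by
  induction L generalizing β with
  | nil =>
    have : (Finsupp.equivFunOnFinite.symm fun _ => 0 : Fin n →₀ ℕ) = 0 := by
      ext; rfl
    simp [this]
  | cons j L ih =>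
    have h1 : (β + Finsupp.single j 1) + Finsupp.equivFunOnFinite.symm (fun i => L.count i)
        = β + Finsupp.equivFunOnFinite.symm fun i => (j :: L).count i := by
      ext i
      simp [List.count_cons, Finsupp.single_apply]
      omega
    have h2 : ∀ i, (β + Finsupp.single j 1 : Fin n →₀ ℕ) i + L.count i = β i + (j :: L).count i := by
      intro i
      simp [List.count_cons, Finsupp.single_apply]
      omega
    have h3 : (∏ i, (((β + Finsupp.single j 1 : Fin n →₀ ℕ) i).factorial : ℝ))
        = (∏ i, ((β i).factorial : ℝ)) * (β j + 1) := by
      rw [← Finset.mul_prod_erase _ _ (Finset.mem_univ j),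
        ← Finset.mul_prod_erase _ (fun i => ((β i).factorial : ℝ)) (Finset.mem_univ j)]
      rw [Finset.prod_congr rfl (g := fun i => ((β i).factorial : ℝ)) fun i hi => by
        simp [(Finset.ne_of_mem_erase hi).symm]]
      simp [Nat.factorial_succ]
      ring
    have := ih (β + Finsupp.single j 1)
    rw [h1, h3] at this
    simp only [h2] at this
    rw [← this, List.foldr_cons, MvPolynomial.coeff_pderiv]
    ring

/-- The homogeneous part of weighted degree `N` of the Taylor series, as a polynomial. -/
noncomputable def homPoly {n : ℕ} (w : Fin n → ℕ) (f : (Fin n → ℝ) → ℝ) (N : ℕ)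
    (S : Finset (Fin n → ℕ)) : MvPolynomial (Fin n) ℝ :=
  ∑ α ∈ S.filter (fun α => wlen w α = N),
    MvPolynomial.monomial (Finsupp.equivFunOnFinite.symm α) (taylorCoeff α f)

theorem eval_homPoly {n : ℕ} (w : Fin n → ℕ) (f : (Fin n → ℝ) → ℝ) (N : ℕ)
    (S : Finset (Fin n → ℕ)) (x : Fin n → ℝ) :
    MvPolynomial.eval x (homPoly w f N S) =
      ∑ α ∈ S.filter (fun α => wlen w α = N), taylorCoeff α f * monom α x := by
  simp [homPoly, MvPolynomial.eval_monomial, monom, Finsupp.prod_fintype]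

theorem eval_dil_homPoly {n : ℕ} (w : Fin n → ℕ) (f : (Fin n → ℝ) → ℝ) (N : ℕ)
    (S : Finset (Fin n → ℕ)) (t : ℝ) (x : Fin n → ℝ) :
    MvPolynomial.eval (dil w t x) (homPoly w f N S) =
      t ^ N * MvPolynomial.eval x (homPoly w f N S) := by
  rw [eval_homPoly, eval_homPoly, Finset.mul_sum]
  refine Finset.sum_congr rfl fun α hα => ?_
  rw [← (Finset.mem_filter.1 hα).2, wlen, ← Finset.prod_pow_eq_pow_sum]
  simp only [monom, dil, mul_pow, Finset.prod_mul_distrib, pow_mul]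
  ring

theorem vfSeq_coord_homPoly_zero {n : ℕ} {w : Fin n → ℕ} (f : (Fin n → ℝ) → ℝ) {N : ℕ}
    {S : Finset (Fin n → ℕ)} (hS : ∀ α, wlen w α = N → α ∈ S) (L : List (Fin n)) :
    vfSeq (coordVF n) L (fun x => MvPolynomial.eval x (homPoly w f N S)) 0 =
      if seqW w L = N then pdPow (fun i => L.count i) f 0 else 0 := by
  have h := factorial_mul_coeff_foldr_pderiv L (homPoly w f N S) 0
  have hc : (homPoly w f N S).coeff (Finsupp.equivFunOnFinite.symm fun i => L.count i) =
      if seqW w L = N then taylorCoeff (fun i => L.count i) f else 0 := by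
    rw [seqW_eq_wlen_count]
    simp only [homPoly, MvPolynomial.coeff_sum, MvPolynomial.coeff_monomial,
      EmbeddingLike.apply_eq_iff_eq, Finset.sum_ite_eq', Finset.mem_filter]
    refine if_congr ⟨fun h => h.2, fun h => ⟨hS _ h, h⟩⟩ rfl rfl
  rw [zero_add, hc] at h
  rw [vfSeq_coord_mvPolynomial_eval]
  simp only [Finsupp.coe_zero, Pi.zero_apply, Nat.factorial_zero, Nat.cast_one,
    Finset.prod_const_one, one_mul, zero_add] at h
  simp only [MvPolynomial.eval_zero, MvPolynomial.constantCoeff_eq, h]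
  split_ifs
  · rw [taylorCoeff, Nat.cast_prod, ← mul_assoc, mul_inv_cancel₀, one_mul]
    exact Finset.prod_ne_zero_iff.2 fun i _ => by positivity
  · simp

/-- If `f` has weight `≥ N`, then `t ^ (-N) f(δ_t x)` extends smoothly through `t = 0`. -/
theorem exists_contDiffOn_rescaled {n : ℕ} {w : Fin n → ℕ} (hw : ∀ i, 0 < w i)
    {U : Set (Fin n → ℝ)} (hU : IsOpen U) (h0 : (0 : Fin n → ℝ) ∈ U)
    (hstar : ∀ x ∈ U, ∀ t : ℝ, |t| ≤ 1 → dil w t x ∈ U) {N : ℕ} {f : (Fin n → ℝ) → ℝ}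
    (hf : ContDiffOn ℝ (⊤ : ℕ∞) f U) (hwt : ∀ α, wlen w α < N → pdPow α f 0 = 0)
    {S : Finset (Fin n → ℕ)} (hS : ∀ α, wlen w α = N → α ∈ S) :
    ∃ G : ℝ × (Fin n → ℝ) → ℝ, ContDiffOn ℝ (⊤ : ℕ∞) G (Set.Ioo (-1 : ℝ) 1 ×ˢ U) ∧
      (∀ t ∈ Set.Ioo (-1 : ℝ) 1, ∀ x ∈ U, f (dil w t x) = t ^ N * G (t, x)) ∧
      ∀ x, G (0, x) =
        ∑ α ∈ S.filter (fun α => wlen w α = N), taylorCoeff α f * monom α x := by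
  have hP := contDiff_mvPolynomial_eval (homPoly w f N S)
  obtain ⟨G, hG, hfG⟩ := exists_contDiffOn_comp_dil_eq_pow_mul hw hU hstar (N + 1)
    (hf.sub hP.contDiffOn) fun L hL => by
      refine (vfSeq_coord_sub hU hf hP.contDiffOn L h0).trans ?_
      simp only
      rw [vfSeq_coord_homPoly_zero f hS, vfSeq_coord_eq_pdPow hU hf L h0]
      split_ifs with h
      · exact sub_self _
      · rw [hwt _ (by rw [← seqW_eq_wlen_count]; omega), sub_zero]
  refine ⟨fun p => MvPolynomial.eval p.2 (homPoly w f N S) + p.1 * G p, ?_, ?_, ?_⟩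
  · exact (hP.comp contDiff_snd).contDiffOn.add (contDiff_fst.contDiffOn.mul hG)
  · intro t ht x hx
    have := hfG t ht x hx
    rw [eval_dil_homPoly] at this
    linear_combination this
  · intro x
    simp [eval_homPoly]

/-- Smooth extension of `t^m δ_t^* X` through `t = 0` when the
components of `X` have weight `≥ w_k - m`. -/
theorem smooth_rescaled_extension
    {n : ℕ} (hn : 0 < n) {w : Fin n → ℕ} (hw : IsWeight w)
    {U : Set (Fin n → ℝ)} (hU : IsOpen U) (h0 : (0 : Fin n → ℝ) ∈ U)
    (hstar : ∀ x ∈ U, ∀ t : ℝ, |t| ≤ 1 → dil w t x ∈ U)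
    {m : ℕ} (hm : 1 ≤ m)
    {X : (Fin n → ℝ) → (Fin n → ℝ)} (hX : ContDiffOn ℝ (⊤ : ℕ∞) X U)
    (hwt : ∀ k, ∀ α : Fin n → ℕ, (wlen w α : ℤ) < (w k : ℤ) - m →
      pdPow α (fun y => X y k) 0 = 0) :
    ∃ Xh : ℝ × (Fin n → ℝ) → Fin n → ℝ,
      ContDiffOn ℝ (⊤ : ℕ∞) Xh (Set.Ioo (-1 : ℝ) 1 ×ˢ U) ∧
      (∀ t : ℝ, t ∈ Set.Ioo (-1 : ℝ) 1 → t ≠ 0 → ∀ x ∈ U, ∀ k,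
        Xh (t, x) k = t ^ m * (t ^ (-(w k : ℤ)) * X (dil w t x) k)) ∧
      (∀ x ∈ U, ∀ k, Xh (0, x) k =
        ∑ α ∈ (mIdx n (w k + 1)).filter (fun α => wlen w α + m = w k),
          taylorCoeff α (fun y => X y k) * monom α x) := by
  have hcomp : ∀ k, ContDiffOn ℝ (⊤ : ℕ∞) (fun y => X y k) U := contDiffOn_pi.1 hX
  have hmem : ∀ k, ∀ α : Fin n → ℕ, wlen w α + m = w k → α ∈ mIdx n (w k + 1) := by
    intro k α hα
    refine Fintype.mem_piFinset.2 fun i => Finset.mem_range.2 ?_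
    have h1 : w i * α i ≤ wlen w α :=
      Finset.single_le_sum (f := fun i => w i * α i) (fun _ _ => Nat.zero_le _)
        (Finset.mem_univ i)
    have h2 : α i ≤ w i * α i := Nat.le_mul_of_pos_left _ (hw.pos i)
    omega
  have component : ∀ k, ∃ G : ℝ × (Fin n → ℝ) → ℝ,
      ContDiffOn ℝ (⊤ : ℕ∞) G (Set.Ioo (-1 : ℝ) 1 ×ˢ U) ∧
      (∀ t : ℝ, t ∈ Set.Ioo (-1 : ℝ) 1 → t ≠ 0 → ∀ x ∈ U,
        G (t, x) = t ^ m * (t ^ (-(w k : ℤ)) * X (dil w t x) k)) ∧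
      ∀ x, G (0, x) = ∑ α ∈ (mIdx n (w k + 1)).filter (fun α => wlen w α + m = w k),
        taylorCoeff α (fun y => X y k) * monom α x := by
    intro k
    rcases le_or_gt m (w k) with hle | hlt
    · obtain ⟨N, hN⟩ := Nat.exists_eq_add_of_le' hle
      have hiff : ∀ α : Fin n → ℕ, wlen w α = N ↔ wlen w α + m = w k := fun α => by omega
      obtain ⟨G, hG, hfG, hG0⟩ := exists_contDiffOn_rescaled hw.pos hU h0 hstar (N := N)
        (hcomp k) (fun α hα => hwt k α (by omega)) fun α hα => hmem k α ((hiff α).1 hα)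
      refine ⟨G, hG, fun t ht ht0 x hx => ?_, fun x => ?_⟩
      · rw [hfG t ht x hx, hN, zpow_neg, zpow_natCast, pow_add]
        field_simp
      · simp only [hG0, hiff]
    · obtain ⟨d, hd⟩ := Nat.exists_eq_add_of_lt hlt
      refine ⟨fun p => p.1 ^ (d + 1) * X (dil w p.1 p.2) k, ?_, fun t ht ht0 x hx => ?_,
        fun x => ?_⟩
      · refine (contDiff_fst.pow _).contDiffOn.mul
          ((hcomp k).comp (contDiff_dil w).contDiffOn fun p hp => ?_)
        exact hstar p.2 hp.2 p.1 (abs_le.2 ⟨hp.1.1.le, hp.1.2.le⟩)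
      · rw [hd, zpow_neg, zpow_natCast, add_assoc, pow_add]
        field_simp
      · rw [Finset.filter_false_of_mem fun α _ => by omega]
        simp
  choose G hG hGt hG0 using component
  exact ⟨fun p k => G k p, contDiffOn_pi.2 hG, fun t ht ht0 x hx k => hGt k t ht ht0 x hx,
    fun x _ k => hG0 k x⟩

end Carnot
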